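/- arXiv:2110.08923 — 2 statements merged into one kernel-verified Lean document; each statement's English description precedes it below -/
import Mathlib

section
/- For any two policies π and π′ with ‖π − π′‖_∞ ≤ ε (the maximum over (s,a) of |π(a|s) − π′(a|s)|), it holds that |V^π(ρ) − V^{π′}(ρ)| ≤ |A|·ε/(1−γ)². -/
open scoped BigOperators

section CMDP

variable {S A : Type} [Fintype S] [Fintype A]

/-- `P` is a transition kernel: each `P s a` is a probability distribution over states. -/
def IsKernel (P : S → A → S → ℝ) : Prop :=
  (∀ s a s', 0 ≤ P s a s') ∧ ∀ s a, ∑ s', P s a s' = 1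

/-- `ρ` is a probability distribution over states. -/
def IsDist (ρ : S → ℝ) : Prop := (∀ s, 0 ≤ ρ s) ∧ ∑ s, ρ s = 1

/-- `π` is a (stationary, stochastic) policy. -/
def IsPolicy (π : S → A → ℝ) : Prop := (∀ s a, 0 ≤ π s a) ∧ ∀ s, ∑ a, π s a = 1

/-- One step of the state-action distribution dynamics under kernel `P` and policy `π`. -/
noncomputable def stepDist (P : S → A → S → ℝ) (π : S → A → ℝ) (μ : S → A → ℝ) :
    S → A → ℝ :=
  fun s a => (∑ s', ∑ a', μ s' a' * P s' a' s) * π s a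

/-- State-action distribution at time `t` of the Markov chain induced by `π`,
with initial state-action distribution `μ₀`. -/
noncomputable def trajSA (P : S → A → S → ℝ) (π : S → A → ℝ) (μ₀ : S → A → ℝ) :
    ℕ → S → A → ℝ
  | 0 => μ₀
  | (t + 1) => stepDist P π (trajSA P π μ₀ t)

/-- Initial state-action distribution when `s₀ ∼ ρ`, `a₀ ∼ π(·|s₀)`. -/
noncomputable def initSA (ρ : S → ℝ) (π : S → A → ℝ) : S → A → ℝ := fun s a => ρ s * π s a

/-- Initial state-action distribution that is a Dirac at `(s₀, a₀)`. -/
noncomputable def diracSA [DecidableEq S] [DecidableEq A] (s₀ : S) (a₀ : A) : S → A → ℝ :=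
  fun s a => if s = s₀ ∧ a = a₀ then 1 else 0

/-- Expected discounted cumulative value `E[∑ γ^t c(s_t,a_t)]` with initial
state-action distribution `μ₀`. -/
noncomputable def dsum (γ : ℝ) (P : S → A → S → ℝ) (π : S → A → ℝ) (μ₀ : S → A → ℝ)
    (c : S → A → ℝ) : ℝ :=
  ∑' t : ℕ, γ ^ t * ∑ s, ∑ a, trajSA P π μ₀ t s a * c s a

/-- Value function `V^π(ρ)` (for reward/utility `c`). -/
noncomputable def Vval (γ : ℝ) (P : S → A → S → ℝ) (π : S → A → ℝ) (ρ : S → ℝ)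
    (c : S → A → ℝ) : ℝ := dsum γ P π (initSA ρ π) c

/-- Q-function `Q^π(s,a)` (for reward/utility `c`). -/
noncomputable def Qval [DecidableEq S] [DecidableEq A] (γ : ℝ) (P : S → A → S → ℝ)
    (π : S → A → ℝ) (s : S) (a : A) (c : S → A → ℝ) : ℝ :=
  dsum γ P π (diracSA s a) c

/-- Discounted state visitation distribution `d_ρ^π(s)`. -/
noncomputable def visit (γ : ℝ) (P : S → A → S → ℝ) (π : S → A → ℝ) (ρ : S → ℝ)
    (s : S) : ℝ :=
  (1 - γ) * ∑' t : ℕ, γ ^ t * ∑ a, trajSA P π (initSA ρ π) t s a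

/-- Discounted entropy `H(ρ, π)`. -/
noncomputable def Hent (γ : ℝ) (P : S → A → S → ℝ) (π : S → A → ℝ) (ρ : S → ℝ) : ℝ :=
  Vval γ P π ρ (fun s a => -Real.log (π s a))

/-- Entropy-regularized value function `V_τ^π(ρ)`. -/
noncomputable def Vtau (γ τ : ℝ) (P : S → A → S → ℝ) (π : S → A → ℝ) (ρ : S → ℝ)
    (c : S → A → ℝ) : ℝ := Vval γ P π ρ c + τ * Hent γ P π ρ

/-- Euclidean norm of a vector indexed by state-action pairs. -/
noncomputable def polNorm2 (x : S → A → ℝ) : ℝ := Real.sqrt (∑ s, ∑ a, (x s a) ^ 2)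

/-- Euclidean norm of a vector in `ℝ^n`. -/
noncomputable def vecNorm2 {n : ℕ} (x : Fin n → ℝ) : ℝ := Real.sqrt (∑ i, (x i) ^ 2)

/-- The soft-max policy associated with parameter `θ`. -/
noncomputable def softmaxPol (θ : S → A → ℝ) : S → A → ℝ :=
  fun s a => Real.exp (θ s a) / ∑ a', Real.exp (θ s a')

/-- Membership in the soft-max policy class `Π`. -/
def InSoftmax (π : S → A → ℝ) : Prop := ∃ θ : S → A → ℝ, π = softmaxPol θ

/-- Lagrangian `L(π, λ)` of the entropy-regularized CMDP. -/
noncomputable def Lag (γ τ : ℝ) (P : S → A → S → ℝ) (ρ : S → ℝ) (r : S → A → ℝ)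
    {n : ℕ} (g : Fin n → S → A → ℝ) (b : Fin n → ℝ) (π : S → A → ℝ)
    (lam : Fin n → ℝ) : ℝ :=
  Vtau γ τ P π ρ r + ∑ i, lam i * (Vval γ P π ρ (g i) - b i)

/-- Dual function `D(λ) = max_{π ∈ Π} L(π, λ)`. -/
noncomputable def Dual (γ τ : ℝ) (P : S → A → S → ℝ) (ρ : S → ℝ) (r : S → A → ℝ)
    {n : ℕ} (g : Fin n → S → A → ℝ) (b : Fin n → ℝ) (lam : Fin n → ℝ) : ℝ :=
  sSup ((fun π : S → A → ℝ => Lag γ τ P ρ r g b π lam) '' {π | InSoftmax π})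

end CMDP

section PolicyPerturbation

variable {S A : Type} [Fintype S] [Fintype A]

/-- The distribution of the next state when the current state-action pair follows `μ`. -/
noncomputable def nextState (P : S → A → S → ℝ) (μ : S → A → ℝ) : S → ℝ :=
  fun s => ∑ s', ∑ a', μ s' a' * P s' a' s

lemma trajSA_succ (P : S → A → S → ℝ) (π μ₀ : S → A → ℝ) (t : ℕ) :
    trajSA P π μ₀ (t + 1) = initSA (nextState P (trajSA P π μ₀ t)) π := rfl

lemma initSA_nonneg {ν : S → ℝ} {π : S → A → ℝ} (hν : IsDist ν) (hπ : IsPolicy π) (s : S)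
    (a : A) : 0 ≤ initSA ν π s a :=
  mul_nonneg (hν.1 s) (hπ.1 s a)

lemma sum_initSA {ν : S → ℝ} {π : S → A → ℝ} (hν : IsDist ν) (hπ : IsPolicy π) :
    ∑ s, ∑ a, initSA ν π s a = 1 := by
  simp only [initSA, ← Finset.mul_sum, hπ.2, mul_one, hν.2]

lemma sum_nextState {P : S → A → S → ℝ} (hP : IsKernel P) (μ : S → A → ℝ) :
    ∑ s, nextState P μ s = ∑ s, ∑ a, μ s a := by
  unfold nextState
  rw [Finset.sum_comm]
  refine Finset.sum_congr rfl fun s _ => ?_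
  rw [Finset.sum_comm]
  refine Finset.sum_congr rfl fun a _ => ?_
  rw [← Finset.mul_sum, hP.2, mul_one]

lemma isDist_nextState {P : S → A → S → ℝ} (hP : IsKernel P) {μ : S → A → ℝ}
    (hμ : ∀ s a, 0 ≤ μ s a) (hμ1 : ∑ s, ∑ a, μ s a = 1) : IsDist (nextState P μ) :=
  ⟨fun s => Finset.sum_nonneg fun s' _ => Finset.sum_nonneg fun a' _ =>
    mul_nonneg (hμ s' a') (hP.1 s' a' s), (sum_nextState hP μ).trans hμ1⟩

/-- The state-action distribution at each time is a state distribution followed by `π`. -/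
lemma exists_trajSA_eq_initSA {P : S → A → S → ℝ} (hP : IsKernel P) {ρ : S → ℝ} (hρ : IsDist ρ)
    {π : S → A → ℝ} (hπ : IsPolicy π) (t : ℕ) :
    ∃ ν, IsDist ν ∧ trajSA P π (initSA ρ π) t = initSA ν π := by
  induction t with
  | zero => exact ⟨ρ, hρ, rfl⟩
  | succ t ih =>
    obtain ⟨ν, hν, h⟩ := ih
    refine ⟨_, ?_, trajSA_succ P π _ t⟩
    rw [h]
    exact isDist_nextState hP (initSA_nonneg hν hπ) (sum_initSA hν hπ)

lemma sum_abs_nextState_sub_le {P : S → A → S → ℝ} (hP : IsKernel P) (μ μ' : S → A → ℝ) :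
    ∑ s, |nextState P μ s - nextState P μ' s| ≤ ∑ s, ∑ a, |μ s a - μ' s a| := by
  rw [← sum_nextState hP fun s a => |μ s a - μ' s a|]
  refine Finset.sum_le_sum fun s _ => ?_
  simp only [nextState, ← Finset.sum_sub_distrib, ← sub_mul]
  refine (Finset.abs_sum_le_sum_abs _ _).trans (Finset.sum_le_sum fun s' _ => ?_)
  refine (Finset.abs_sum_le_sum_abs _ _).trans (Finset.sum_le_sum fun a' _ => ?_)
  rw [abs_mul, abs_of_nonneg (hP.1 s' a' s)]

lemma sum_abs_initSA_sub_le {ν ν' : S → ℝ} (hν' : IsDist ν') {π π' : S → A → ℝ}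
    (hπ : IsPolicy π) {ε : ℝ} (hsup : ∀ s a, |π s a - π' s a| ≤ ε) :
    ∑ s, ∑ a, |initSA ν π s a - initSA ν' π' s a| ≤
      ∑ s, |ν s - ν' s| + Fintype.card A * ε := by
  have key : ∀ s, ∑ a, |initSA ν π s a - initSA ν' π' s a| ≤
      |ν s - ν' s| + ν' s * (Fintype.card A * ε) := by
    intro s
    calc ∑ a, |initSA ν π s a - initSA ν' π' s a|
        ≤ ∑ a, (|ν s - ν' s| * π s a + ν' s * ε) := by
          refine Finset.sum_le_sum fun a _ => ?_
          have h : initSA ν π s a - initSA ν' π' s a =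
              (ν s - ν' s) * π s a + ν' s * (π s a - π' s a) := by
            unfold initSA
            ring
          rw [h]
          refine (abs_add_le _ _).trans ?_
          rw [abs_mul, abs_mul, abs_of_nonneg (hπ.1 s a), abs_of_nonneg (hν'.1 s)]
          gcongr
          · exact hν'.1 s
          · exact hsup s a
      _ = |ν s - ν' s| + ν' s * (Fintype.card A * ε) := by
          rw [Finset.sum_add_distrib, ← Finset.mul_sum, hπ.2, Finset.sum_const, Finset.card_univ,
            nsmul_eq_mul]
          ring
  refine (Finset.sum_le_sum fun s _ => key s).trans_eq ?_
  rw [Finset.sum_add_distrib, ← Finset.sum_mul, hν'.2, one_mul]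

/-- The `ℓ¹` distance between the state-action distributions of two policies grows at most
linearly in time. -/
lemma sum_abs_trajSA_sub_le {P : S → A → S → ℝ} (hP : IsKernel P) {ρ : S → ℝ} (hρ : IsDist ρ)
    {π π' : S → A → ℝ} (hπ : IsPolicy π) (hπ' : IsPolicy π') {ε : ℝ}
    (hsup : ∀ s a, |π s a - π' s a| ≤ ε) (t : ℕ) :
    ∑ s, ∑ a, |trajSA P π (initSA ρ π) t s a - trajSA P π' (initSA ρ π') t s a| ≤
      (t + 1) * (Fintype.card A * ε) := by
  induction t with
  | zero => simpa [trajSA] using sum_abs_initSA_sub_le (ν := ρ) hρ hπ hsup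
  | succ t ih =>
    obtain ⟨ν, hν, h⟩ := exists_trajSA_eq_initSA hP hρ hπ' t
    have hd : IsDist (nextState P (trajSA P π' (initSA ρ π') t)) := by
      rw [h]
      exact isDist_nextState hP (initSA_nonneg hν hπ') (sum_initSA hν hπ')
    rw [trajSA_succ, trajSA_succ]
    refine (sum_abs_initSA_sub_le hd hπ hsup).trans ?_
    have := sum_abs_nextState_sub_le hP (trajSA P π (initSA ρ π) t) (trajSA P π' (initSA ρ π') t)
    push_cast
    linarith

lemma summable_dsum {P : S → A → S → ℝ} (hP : IsKernel P) {r : S → A → ℝ}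
    (hr : ∀ s a, r s a ∈ Set.Icc (0 : ℝ) 1) {γ : ℝ} (hγ : γ ∈ Set.Ico (0 : ℝ) 1) {ρ : S → ℝ}
    (hρ : IsDist ρ) {π : S → A → ℝ} (hπ : IsPolicy π) :
    Summable fun t : ℕ => γ ^ t * ∑ s, ∑ a, trajSA P π (initSA ρ π) t s a * r s a := by
  refine Summable.of_nonneg_of_le (fun t => ?_) (fun t => ?_)
    (summable_geometric_of_lt_one hγ.1 hγ.2)
  all_goals
    obtain ⟨ν, hν, h⟩ := exists_trajSA_eq_initSA hP hρ hπ t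
    rw [h]
  · exact mul_nonneg (pow_nonneg hγ.1 t) (Finset.sum_nonneg fun s _ => Finset.sum_nonneg fun a _ =>
      mul_nonneg (initSA_nonneg hν hπ s a) (hr s a).1)
  · refine mul_le_of_le_one_right (pow_nonneg hγ.1 t) ?_
    rw [← sum_initSA hν hπ]
    exact Finset.sum_le_sum fun s _ => Finset.sum_le_sum fun a _ =>
      mul_le_of_le_one_right (initSA_nonneg hν hπ s a) (hr s a).2

lemma abs_sum_mul_sub_sum_mul_le {r : S → A → ℝ} (hr : ∀ s a, r s a ∈ Set.Icc (0 : ℝ) 1)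
    (μ μ' : S → A → ℝ) :
    |∑ s, ∑ a, μ s a * r s a - ∑ s, ∑ a, μ' s a * r s a| ≤ ∑ s, ∑ a, |μ s a - μ' s a| := by
  simp only [← Finset.sum_sub_distrib, ← sub_mul]
  refine (Finset.abs_sum_le_sum_abs _ _).trans (Finset.sum_le_sum fun s _ => ?_)
  refine (Finset.abs_sum_le_sum_abs _ _).trans (Finset.sum_le_sum fun a _ => ?_)
  rw [abs_mul, abs_of_nonneg (hr s a).1]
  exact mul_le_of_le_one_right (abs_nonneg _) (hr s a).2

end PolicyPerturbation

/-- if `‖π − π′‖_∞ ≤ ε` then `|V^π(ρ) − V^{π′}(ρ)| ≤ |A|·ε/(1−γ)²`. -/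
theorem value_diff_le_of_sup_norm
    {S A : Type} [Fintype S] [Fintype A]
    (P : S → A → S → ℝ) (r : S → A → ℝ) (γ : ℝ) (ρ : S → ℝ)
    (hP : IsKernel P) (hr : ∀ s a, r s a ∈ Set.Icc (0 : ℝ) 1)
    (hγ : γ ∈ Set.Ico (0 : ℝ) 1) (hρ : IsDist ρ)
    (π π' : S → A → ℝ) (hπ : IsPolicy π) (hπ' : IsPolicy π')
    (ε : ℝ) (hsup : ∀ s a, |π s a - π' s a| ≤ ε) :
    |Vval γ P π ρ r - Vval γ P π' ρ r| ≤ (Fintype.card A) * ε / (1 - γ) ^ 2 := by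
  have hgeom : HasSum (fun t : ℕ => ((t : ℝ) + 1) * γ ^ t * (Fintype.card A * ε))
      (Fintype.card A * ε / (1 - γ) ^ 2) := by
    have h := hasSum_choose_mul_geometric_of_norm_lt_one 1
      (show ‖γ‖ < 1 by rw [Real.norm_of_nonneg hγ.1]; exact hγ.2)
    simpa [one_add_one_eq_two, inv_mul_eq_div] using h.mul_right (Fintype.card A * ε)
  unfold Vval dsum
  rw [← (summable_dsum hP hr hγ hρ hπ).tsum_sub (summable_dsum hP hr hγ hρ hπ'),
    ← Real.norm_eq_abs]
  refine tsum_of_norm_bounded hgeom fun t => ?_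
  rw [← mul_sub, Real.norm_eq_abs, abs_mul, abs_of_nonneg (pow_nonneg hγ.1 t), mul_comm _ (γ ^ t),
    mul_assoc]
  exact mul_le_mul_of_nonneg_left ((abs_sum_mul_sub_sum_mul_le hr _ _).trans
    (sum_abs_trajSA_sub_le hP hρ hπ hπ' hsup t)) (pow_nonneg hγ.1 t)
end

section
/- Under the Slater, strong duality and exploration assumptions, the map λ ↦ π_λ is Lipschitz on Λ: with ℓ_Λ = (√(n|A|)/(1−γ)² + 1)·2·(1−γ)·ln2/(τ·d), it holds that ‖π_{λ₁} − π_{λ₂}‖₂ ≤ ℓ_Λ·‖λ₁ − λ₂‖₂ for all λ₁, λ₂ ∈ Λ. -/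
open scoped BigOperators

section Occupancy

variable {S A : Type} [Fintype A]

lemma InSoftmax.pos {π : S → A → ℝ} (h : InSoftmax π) (s : S) (a : A) : 0 < π s a := by
  obtain ⟨θ, rfl⟩ := h
  exact div_pos (Real.exp_pos _)
    (Finset.sum_pos (fun _ _ => Real.exp_pos _) ⟨a, Finset.mem_univ a⟩)

lemma InSoftmax.sum_eq_one [Nonempty A] {π : S → A → ℝ} (h : InSoftmax π) (s : S) :
    ∑ a, π s a = 1 := by
  obtain ⟨θ, rfl⟩ := h
  have : 0 < ∑ a, Real.exp (θ s a) :=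
    Finset.sum_pos (fun _ _ => Real.exp_pos _) Finset.univ_nonempty
  simp only [softmaxPol, ← Finset.sum_div]
  exact div_self this.ne'

lemma InSoftmax.isPolicy [Nonempty A] {π : S → A → ℝ} (h : InSoftmax π) : IsPolicy π :=
  ⟨fun s a => (h.pos s a).le, h.sum_eq_one⟩

variable [Fintype S]

/-- Discounted state-action occupancy measure of `π` started from `ρ`. -/
noncomputable def occupancy (γ : ℝ) (P : S → A → S → ℝ) (π : S → A → ℝ) (ρ : S → ℝ)
    (s : S) (a : A) : ℝ :=
  ∑' t : ℕ, γ ^ t * trajSA P π (initSA ρ π) t s a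

lemma trajSA_nonneg {P : S → A → S → ℝ} {π : S → A → ℝ} {ρ : S → ℝ}
    (hP : IsKernel P) (hπ : IsPolicy π) (hρ : IsDist ρ) (t : ℕ) (s : S) (a : A) :
    0 ≤ trajSA P π (initSA ρ π) t s a := by
  induction t generalizing s a with
  | zero => exact mul_nonneg (hρ.1 s) (hπ.1 s a)
  | succ t ih =>
    exact mul_nonneg (Finset.sum_nonneg fun s' _ => Finset.sum_nonneg fun a' _ =>
      mul_nonneg (ih s' a') (hP.1 s' a' s)) (hπ.1 s a)

lemma sum_flow {P : S → A → S → ℝ} (hP : IsKernel P) (μ : S → A → ℝ) :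
    ∑ s, ∑ s', ∑ a', μ s' a' * P s' a' s = ∑ s', ∑ a', μ s' a' := by
  rw [Finset.sum_comm]
  refine Finset.sum_congr rfl fun s' _ => ?_
  rw [Finset.sum_comm]
  refine Finset.sum_congr rfl fun a' _ => ?_
  rw [← Finset.mul_sum, hP.2, mul_one]

lemma sum_trajSA {P : S → A → S → ℝ} {π : S → A → ℝ} {ρ : S → ℝ}
    (hP : IsKernel P) (hπ : IsPolicy π) (hρ : IsDist ρ) (t : ℕ) :
    ∑ s, ∑ a, trajSA P π (initSA ρ π) t s a = 1 := by
  induction t with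
  | zero => simp only [trajSA, initSA, ← Finset.mul_sum, hπ.2, mul_one, hρ.2]
  | succ t ih =>
    simp only [trajSA, stepDist, ← Finset.mul_sum, hπ.2, mul_one]
    rw [sum_flow hP, ih]

lemma trajSA_le_one {P : S → A → S → ℝ} {π : S → A → ℝ} {ρ : S → ℝ}
    (hP : IsKernel P) (hπ : IsPolicy π) (hρ : IsDist ρ) (t : ℕ) (s : S) (a : A) :
    trajSA P π (initSA ρ π) t s a ≤ 1 := by
  rw [← sum_trajSA hP hπ hρ t]
  have h := trajSA_nonneg hP hπ hρ t
  exact (Finset.single_le_sum (fun a _ => h s a) (Finset.mem_univ a)).trans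
    (Finset.single_le_sum (f := fun s => ∑ a, trajSA P π (initSA ρ π) t s a)
      (fun s _ => Finset.sum_nonneg fun a _ => h s a) (Finset.mem_univ s))

variable {γ : ℝ} {P : S → A → S → ℝ} {π : S → A → ℝ} {ρ : S → ℝ}

lemma summable_trajSA (hγ : γ ∈ Set.Ico (0 : ℝ) 1) (hP : IsKernel P) (hπ : IsPolicy π)
    (hρ : IsDist ρ) (s : S) (a : A) :
    Summable fun t : ℕ => γ ^ t * trajSA P π (initSA ρ π) t s a :=
  Summable.of_nonneg_of_le
    (fun t => mul_nonneg (pow_nonneg hγ.1 t) (trajSA_nonneg hP hπ hρ t s a))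
    (fun t => mul_le_of_le_one_right (pow_nonneg hγ.1 t) (trajSA_le_one hP hπ hρ t s a))
    (summable_geometric_of_lt_one hγ.1 hγ.2)

lemma Vval_eq_sum_occupancy (hγ : γ ∈ Set.Ico (0 : ℝ) 1) (hP : IsKernel P) (hπ : IsPolicy π)
    (hρ : IsDist ρ) (c : S → A → ℝ) :
    Vval γ P π ρ c = ∑ s, ∑ a, occupancy γ P π ρ s a * c s a := by
  have hs := summable_trajSA hγ hP hπ hρ
  simp only [Vval, dsum, occupancy, ← tsum_mul_right]
  rw [show (∑ s, ∑ a, ∑' t : ℕ, γ ^ t * trajSA P π (initSA ρ π) t s a * c s a) =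
      ∑ s, ∑' t : ℕ, ∑ a, γ ^ t * trajSA P π (initSA ρ π) t s a * c s a from
    Finset.sum_congr rfl fun s _ =>
      (Summable.tsum_finsetSum fun a _ => (hs s a).mul_right (c s a)).symm]
  rw [← Summable.tsum_finsetSum fun s _ => summable_sum fun a _ => (hs s a).mul_right (c s a)]
  simp only [Finset.mul_sum, mul_assoc]

lemma visit_eq_sum_occupancy (hγ : γ ∈ Set.Ico (0 : ℝ) 1) (hP : IsKernel P) (hπ : IsPolicy π)
    (hρ : IsDist ρ) (s : S) :
    visit γ P π ρ s = (1 - γ) * ∑ a, occupancy γ P π ρ s a := by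
  simp only [visit, occupancy]
  rw [← Summable.tsum_finsetSum fun a _ => summable_trajSA hγ hP hπ hρ s a]
  simp only [Finset.mul_sum]

lemma occupancy_flow (hγ : γ ∈ Set.Ico (0 : ℝ) 1) (hP : IsKernel P) (hπ : IsPolicy π)
    (hρ : IsDist ρ) (s : S) (a : A) :
    occupancy γ P π ρ s a =
      (ρ s + γ * ∑ s', ∑ a', occupancy γ P π ρ s' a' * P s' a' s) * π s a := by
  have hs := summable_trajSA hγ hP hπ hρ
  have key : ∑ s', ∑ a', occupancy γ P π ρ s' a' * P s' a' s =
      ∑' t : ℕ, γ ^ t * ∑ s', ∑ a', trajSA P π (initSA ρ π) t s' a' * P s' a' s :=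
    (Vval_eq_sum_occupancy hγ hP hπ hρ fun s' a' => P s' a' s).symm
  rw [key, occupancy, (hs s a).tsum_eq_zero_add, add_mul, ← tsum_mul_left, ← tsum_mul_right]
  congr 1
  · simp [trajSA, initSA]
  · refine tsum_congr fun t => ?_
    simp only [trajSA, stepDist]
    ring

lemma sum_occupancy_flow (hγ : γ ∈ Set.Ico (0 : ℝ) 1) (hP : IsKernel P) (hπ : IsPolicy π)
    (hρ : IsDist ρ) (s : S) :
    ∑ a, occupancy γ P π ρ s a =
      ρ s + γ * ∑ s', ∑ a', occupancy γ P π ρ s' a' * P s' a' s := by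
  rw [Finset.sum_congr rfl fun a _ => occupancy_flow hγ hP hπ hρ s a, ← Finset.mul_sum, hπ.2,
    mul_one]

lemma sum_visit (hγ : γ ∈ Set.Ico (0 : ℝ) 1) (hP : IsKernel P) (hπ : IsPolicy π)
    (hρ : IsDist ρ) : ∑ s, visit γ P π ρ s = 1 := by
  have h : ∑ s, ∑ a, occupancy γ P π ρ s a =
      ∑ s, (ρ s + γ * ∑ s', ∑ a', occupancy γ P π ρ s' a' * P s' a' s) :=
    Finset.sum_congr rfl fun s _ => sum_occupancy_flow hγ hP hπ hρ s
  rw [Finset.sum_add_distrib, hρ.2, ← Finset.mul_sum, sum_flow hP] at h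
  simp only [visit_eq_sum_occupancy hγ hP hπ hρ, ← Finset.mul_sum]
  linarith

/-- Soft performance-difference identity: if `q` is the soft-max policy of the soft action values
associated with `V`, the regularized value of `π` falls short of `V` by the discounted
Kullback-Leibler divergence from `π` to `q`. -/
lemma sum_occupancy_regularized (hγ : γ ∈ Set.Ico (0 : ℝ) 1) (hP : IsKernel P)
    (hπ : IsPolicy π) (hρ : IsDist ρ) {τ : ℝ} {c q : S → A → ℝ} {V : S → ℝ}
    (hq : ∀ s a, τ * Real.log (q s a) = c s a + γ * ∑ s', P s a s' * V s' - V s) :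
    ∑ s, ∑ a, occupancy γ P π ρ s a * (c s a - τ * Real.log (π s a)) =
      ∑ s, ρ s * V s - τ * ∑ s, (∑ a, occupancy γ P π ρ s a) *
        ∑ a, π s a * (Real.log (π s a) - Real.log (q s a)) := by
  have hocc : ∀ s a, occupancy γ P π ρ s a = (∑ a', occupancy γ P π ρ s a') * π s a :=
    fun s a => by rw [sum_occupancy_flow hγ hP hπ hρ]; exact occupancy_flow hγ hP hπ hρ s a
  have hV : ∑ s, ∑ a, occupancy γ P π ρ s a * (γ * ∑ s', P s a s' * V s') =
      ∑ s, (∑ a, occupancy γ P π ρ s a) * V s - ∑ s, ρ s * V s := by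
    rw [← Finset.sum_sub_distrib]
    have h1 : ∀ s, (∑ a, occupancy γ P π ρ s a) * V s - ρ s * V s =
        ∑ s', ∑ a', occupancy γ P π ρ s' a' * (γ * (P s' a' s * V s)) := fun s => by
      rw [sum_occupancy_flow hγ hP hπ hρ s, add_mul, add_sub_cancel_left, mul_assoc,
        Finset.sum_mul, Finset.mul_sum]
      refine Finset.sum_congr rfl fun s' _ => ?_
      rw [Finset.sum_mul, Finset.mul_sum]
      exact Finset.sum_congr rfl fun a' _ => by ring
    rw [Finset.sum_congr rfl fun s _ => h1 s]
    symm
    rw [Finset.sum_comm]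
    refine Finset.sum_congr rfl fun s' _ => ?_
    rw [Finset.sum_comm]
    simp only [Finset.mul_sum]
  have hK : τ * ∑ s, (∑ a, occupancy γ P π ρ s a) *
        ∑ a, π s a * (Real.log (π s a) - Real.log (q s a)) =
      ∑ s, ∑ a, occupancy γ P π ρ s a * (τ * Real.log (π s a) - τ * Real.log (q s a)) := by
    rw [Finset.mul_sum]
    refine Finset.sum_congr rfl fun s _ => ?_
    rw [Finset.mul_sum, Finset.mul_sum]
    refine Finset.sum_congr rfl fun a _ => ?_
    rw [hocc s a]
    ring
  have hsplit : ∑ s, ∑ a, occupancy γ P π ρ s a * (c s a - τ * Real.log (π s a)) =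
      ∑ s, (∑ a, occupancy γ P π ρ s a) * V s
      - ∑ s, ∑ a, occupancy γ P π ρ s a * (γ * ∑ s', P s a s' * V s')
      - ∑ s, ∑ a, occupancy γ P π ρ s a *
          (τ * Real.log (π s a) - τ * Real.log (q s a)) := by
    simp only [Finset.sum_mul, ← Finset.sum_sub_distrib]
    refine Finset.sum_congr rfl fun s _ => Finset.sum_congr rfl fun a _ => ?_
    rw [hq]
    ring
  rw [hsplit, hK, hV]
  ring

/-- The Lagrangian is the entropy-regularized value for the reward `r + ∑ i, λ i • g i`. -/
lemma Lag_eq_sum_occupancy (hγ : γ ∈ Set.Ico (0 : ℝ) 1) (hP : IsKernel P) (hπ : IsPolicy π)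
    (hρ : IsDist ρ) (τ : ℝ) (r : S → A → ℝ) {n : ℕ} (g : Fin n → S → A → ℝ)
    (b lam : Fin n → ℝ) :
    Lag γ τ P ρ r g b π lam =
      ∑ s, ∑ a, occupancy γ P π ρ s a *
        ((r s a + ∑ i, lam i * g i s a) - τ * Real.log (π s a)) - ∑ i, lam i * b i := by
  have hg : ∑ i, lam i * ∑ s, ∑ a, occupancy γ P π ρ s a * g i s a =
      ∑ s, ∑ a, occupancy γ P π ρ s a * ∑ i, lam i * g i s a := by
    simp only [Finset.mul_sum]
    rw [Finset.sum_comm]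
    refine Finset.sum_congr rfl fun s _ => ?_
    rw [Finset.sum_comm]
    exact Finset.sum_congr rfl fun a _ => Finset.sum_congr rfl fun i _ => by ring
  simp only [Lag, Vtau, Hent, Vval_eq_sum_occupancy hγ hP hπ hρ, mul_sub,
    Finset.sum_sub_distrib]
  rw [hg]
  simp only [mul_add, Finset.sum_add_distrib, mul_neg, Finset.sum_neg_distrib]
  have : τ * ∑ s, ∑ a, occupancy γ P π ρ s a * Real.log (π s a) =
      ∑ s, ∑ a, occupancy γ P π ρ s a * (τ * Real.log (π s a)) := by
    simp only [Finset.mul_sum]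
    exact Finset.sum_congr rfl fun s _ => Finset.sum_congr rfl fun a _ => by ring
  rw [this]
  ring

end Occupancy

section SoftBellman

variable {S A : Type}

/-- Soft action values of the reward `c` and the state values `V`. -/
noncomputable def softQ [Fintype S] (γ : ℝ) (P : S → A → S → ℝ) (c : S → A → ℝ)
    (V : S → ℝ) (s : S) (a : A) : ℝ := c s a + γ * ∑ s', P s a s' * V s'

lemma abs_softQ_sub_le [Fintype S] {γ : ℝ} {P : S → A → S → ℝ} (hγ : 0 ≤ γ)
    (hP : IsKernel P) {c₁ c₂ : S → A → ℝ} {V₁ V₂ : S → ℝ} {ε : ℝ}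
    (hc : ∀ s a, |c₁ s a - c₂ s a| ≤ ε) (s : S) (a : A) :
    |softQ γ P c₁ V₁ s a - softQ γ P c₂ V₂ s a| ≤ ε + γ * dist V₁ V₂ := by
  have hsum : |∑ s', P s a s' * V₁ s' - ∑ s', P s a s' * V₂ s'| ≤ dist V₁ V₂ := by
    rw [← Finset.sum_sub_distrib]
    calc _ ≤ ∑ s', |P s a s' * V₁ s' - P s a s' * V₂ s'| := Finset.abs_sum_le_sum_abs _ _
      _ ≤ ∑ s', P s a s' * dist V₁ V₂ := by
        refine Finset.sum_le_sum fun s' _ => ?_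
        rw [← mul_sub, abs_mul, abs_of_nonneg (hP.1 s a s')]
        exact mul_le_mul_of_nonneg_left (dist_le_pi_dist V₁ V₂ s') (hP.1 s a s')
      _ = dist V₁ V₂ := by rw [← Finset.sum_mul, hP.2, one_mul]
  calc _ = |(c₁ s a - c₂ s a) + γ * (∑ s', P s a s' * V₁ s' - ∑ s', P s a s' * V₂ s')| := by
        rw [softQ, softQ]; congr 1; ring
    _ ≤ |c₁ s a - c₂ s a| + |γ * (∑ s', P s a s' * V₁ s' - ∑ s', P s a s' * V₂ s')| :=
        abs_add_le _ _
    _ ≤ _ := by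
      rw [abs_mul, abs_of_nonneg hγ]
      exact add_le_add (hc s a) (mul_le_mul_of_nonneg_left hsum hγ)

variable [Fintype A]

lemma mul_log_sum_exp_le [Nonempty A] {τ ε : ℝ} (hτ : 0 < τ) {x y : A → ℝ}
    (h : ∀ a, x a ≤ y a + ε) :
    τ * Real.log (∑ a, Real.exp (x a / τ)) ≤ τ * Real.log (∑ a, Real.exp (y a / τ)) + ε := by
  have hpos : ∀ z : A → ℝ, 0 < ∑ a, Real.exp (z a / τ) := fun z =>
    Finset.sum_pos (fun _ _ => Real.exp_pos _) Finset.univ_nonempty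
  have hle : ∑ a, Real.exp (x a / τ) ≤ (∑ a, Real.exp (y a / τ)) * Real.exp (ε / τ) := by
    rw [Finset.sum_mul]
    refine Finset.sum_le_sum fun a _ => ?_
    rw [← Real.exp_add, ← add_div]
    exact Real.exp_le_exp.2 (div_le_div_of_nonneg_right (h a) hτ.le)
  have hlog := Real.log_le_log (hpos x) hle
  rw [Real.log_mul (hpos y).ne' (Real.exp_pos _).ne', Real.log_exp] at hlog
  calc _ ≤ τ * (Real.log (∑ a, Real.exp (y a / τ)) + ε / τ) :=
        mul_le_mul_of_nonneg_left hlog hτ.le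
    _ = _ := by rw [mul_add, mul_div_cancel₀ _ hτ.ne']

lemma abs_mul_log_sum_exp_sub_le [Nonempty A] {τ ε : ℝ} (hτ : 0 < τ) {x y : A → ℝ}
    (h : ∀ a, |x a - y a| ≤ ε) :
    |τ * Real.log (∑ a, Real.exp (x a / τ)) - τ * Real.log (∑ a, Real.exp (y a / τ))| ≤ ε := by
  have h1 := mul_log_sum_exp_le (x := x) (y := y) (ε := ε) hτ
    fun a => by linarith [(abs_le.1 (h a)).2]
  have h2 := mul_log_sum_exp_le (x := y) (y := x) (ε := ε) hτ
    fun a => by linarith [(abs_le.1 (h a)).1]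
  rw [abs_le]
  constructor <;> linarith

/-- A probability vector whose relative entropy to a positive probability vector is nonpositive
coincides with it. -/
lemma eq_of_sum_mul_log_sub_log_nonpos {p q : A → ℝ} (hp : ∀ a, 0 < p a) (hq : ∀ a, 0 < q a)
    (hpq : ∑ a, p a = ∑ a, q a) (h : ∑ a, p a * (Real.log (p a) - Real.log (q a)) ≤ 0) :
    p = q := by
  have hterm : ∀ a, p a - q a ≤ p a * (Real.log (p a) - Real.log (q a)) := fun a => by
    have := Real.log_le_sub_one_of_pos (div_pos (hq a) (hp a))
    rw [Real.log_div (hq a).ne' (hp a).ne'] at this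
    have h2 := mul_le_mul_of_nonneg_left this (hp a).le
    rw [mul_sub (p a) (q a / p a), mul_div_cancel₀ _ (hp a).ne'] at h2
    linarith
  funext a
  by_contra hne
  have hlt : p a - q a < p a * (Real.log (p a) - Real.log (q a)) := by
    have := Real.log_lt_sub_one_of_pos (div_pos (hq a) (hp a))
      fun h1 => hne ((div_eq_one_iff_eq (hp a).ne').1 h1).symm
    rw [Real.log_div (hq a).ne' (hp a).ne'] at this
    have h2 := mul_lt_mul_of_pos_left this (hp a)
    rw [mul_sub (p a) (q a / p a), mul_div_cancel₀ _ (hp a).ne'] at h2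
    linarith
  have := Finset.sum_lt_sum (fun a _ => hterm a) ⟨a, Finset.mem_univ a, hlt⟩
  rw [Finset.sum_sub_distrib, hpq, sub_self] at this
  linarith

lemma sum_mul_log_sub_log_nonneg {p q : A → ℝ} (hp : ∀ a, 0 < p a) (hq : ∀ a, 0 < q a)
    (hpq : ∑ a, p a = ∑ a, q a) : 0 ≤ ∑ a, p a * (Real.log (p a) - Real.log (q a)) := by
  by_contra! h
  have hpq' := eq_of_sum_mul_log_sub_log_nonpos hp hq hpq h.le
  simp [hpq'] at h

lemma sq_sub_le_mul_log_sub_log {x y : ℝ} (hx : 0 < x) (hy : 0 < y) (hx1 : x ≤ 1)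
    (hy1 : y ≤ 1) : (x - y) ^ 2 ≤ (x - y) * (Real.log x - Real.log y) := by
  wlog hxy : y ≤ x generalizing x y
  · have := this hy hx hy1 hx1 (le_of_not_ge hxy)
    linarith
  have h := Real.log_le_sub_one_of_pos (div_pos hy hx)
  rw [Real.log_div hy.ne' hx.ne'] at h
  have h2 : x - y ≤ 1 - y / x := by
    rw [one_sub_div hx.ne', le_div_iff₀ hx]
    nlinarith
  nlinarith

/-- Euclidean distance of two probability vectors from a uniform bound on the difference of their
logarithms, up to a common shift `k`. -/
lemma sum_sq_sub_le_of_log_sub_log {p q : A → ℝ} (hp : ∀ a, 0 < p a) (hq : ∀ a, 0 < q a)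
    (hp1 : ∑ a, p a = 1) (hq1 : ∑ a, q a = 1) {k δ : ℝ}
    (h : ∀ a, |Real.log (p a) - Real.log (q a) - k| ≤ δ) :
    ∑ a, (p a - q a) ^ 2 ≤ Fintype.card A * δ ^ 2 := by
  have hle : ∀ {w : A → ℝ}, (∀ a, 0 < w a) → ∑ a, w a = 1 → ∀ a, w a ≤ 1 := fun hw hw1 a =>
    hw1 ▸ Finset.single_le_sum (fun a _ => (hw a).le) (Finset.mem_univ a)
  have h0 : ∑ a, (p a - q a) * k = 0 := by
    rw [← Finset.sum_mul, Finset.sum_sub_distrib, hp1, hq1, sub_self, zero_mul]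
  have h1 : ∑ a, (p a - q a) ^ 2 ≤
      ∑ a, (p a - q a) * (Real.log (p a) - Real.log (q a) - k) := by
    simp only [mul_sub _ _ k, Finset.sum_sub_distrib, h0, sub_zero]
    exact Finset.sum_le_sum fun a _ =>
      sq_sub_le_mul_log_sub_log (hp a) (hq a) (hle hp hp1 a) (hle hq hq1 a)
  have h2 : ∑ a, (p a - q a) * (Real.log (p a) - Real.log (q a) - k) ≤
      ∑ a, ((p a - q a) ^ 2 / 2 + δ ^ 2 / 2) := by
    refine Finset.sum_le_sum fun a _ => ?_
    have := sq_le_sq' (abs_le.1 (h a)).1 (abs_le.1 (h a)).2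
    nlinarith [sq_nonneg (p a - q a - (Real.log (p a) - Real.log (q a) - k))]
  rw [Finset.sum_add_distrib, ← Finset.sum_div, Finset.sum_const, Finset.card_univ,
    nsmul_eq_mul] at h2
  linarith

variable [Fintype S] {γ τ : ℝ} {P : S → A → S → ℝ}

/-- Soft Bellman optimality operator. -/
noncomputable def softBellman (γ τ : ℝ) (P : S → A → S → ℝ) (c : S → A → ℝ) (V : S → ℝ) :
    S → ℝ := fun s => τ * Real.log (∑ a, Real.exp (softQ γ P c V s a / τ))

lemma dist_softBellman_le [Nonempty A] (hγ : 0 ≤ γ) (hτ : 0 < τ) (hP : IsKernel P)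
    {c₁ c₂ : S → A → ℝ} {ε : ℝ} (hε : 0 ≤ ε) (hc : ∀ s a, |c₁ s a - c₂ s a| ≤ ε)
    (V₁ V₂ : S → ℝ) :
    dist (softBellman γ τ P c₁ V₁) (softBellman γ τ P c₂ V₂) ≤ ε + γ * dist V₁ V₂ :=
  (dist_pi_le_iff (by positivity)).2 fun s =>
    abs_mul_log_sum_exp_sub_le hτ fun a => abs_softQ_sub_le hγ hP hc s a

lemma exists_softBellman_fixedPoint [Nonempty A] (hγ : γ ∈ Set.Ico (0 : ℝ) 1) (hτ : 0 < τ)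
    (hP : IsKernel P) (c : S → A → ℝ) : ∃ V, softBellman γ τ P c V = V := by
  have hcontr : ContractingWith ⟨γ, hγ.1⟩ (softBellman γ τ P c) :=
    ⟨by exact_mod_cast hγ.2, LipschitzWith.of_dist_le_mul fun V₁ V₂ =>
      (dist_softBellman_le hγ.1 hτ hP le_rfl (c₁ := c) (c₂ := c)
        (fun s a => by simp) V₁ V₂).trans_eq (zero_add _)⟩
  exact ⟨_, hcontr.fixedPoint_isFixedPt⟩

lemma mul_log_softmaxPol_softQ [Nonempty A] (hτ : 0 < τ) {c : S → A → ℝ} {V : S → ℝ}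
    (hV : softBellman γ τ P c V = V) (s : S) (a : A) :
    τ * Real.log (softmaxPol (fun s a => softQ γ P c V s a / τ) s a) =
      softQ γ P c V s a - V s := by
  have hpos : 0 < ∑ a, Real.exp (softQ γ P c V s a / τ) :=
    Finset.sum_pos (fun _ _ => Real.exp_pos _) Finset.univ_nonempty
  have hs : τ * Real.log (∑ a, Real.exp (softQ γ P c V s a / τ)) = V s := congrFun hV s
  rw [softmaxPol, Real.log_div (Real.exp_pos _).ne' hpos.ne', Real.log_exp, mul_sub, hs,
    mul_div_cancel₀ _ hτ.ne']

/-- A maximizer of the Lagrangian is the soft-max policy of the soft optimal action values. -/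
lemma eq_softmaxPol_of_forall_Lag_le [Nonempty A] (hγ : γ ∈ Set.Ico (0 : ℝ) 1) (hτ : 0 < τ)
    (hP : IsKernel P) {ρ : S → ℝ} (hρ : IsDist ρ) {r : S → A → ℝ} {n : ℕ}
    {g : Fin n → S → A → ℝ} {b lam : Fin n → ℝ} {π : S → A → ℝ} (hπ : InSoftmax π)
    (hvisit : ∀ s, 0 < visit γ P π ρ s)
    (hmax : ∀ π' : S → A → ℝ, InSoftmax π' →
      Lag γ τ P ρ r g b π' lam ≤ Lag γ τ P ρ r g b π lam)
    {V : S → ℝ} (hV : softBellman γ τ P (fun s a => r s a + ∑ i, lam i * g i s a) V = V) :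
    π = softmaxPol fun s a => softQ γ P (fun s a => r s a + ∑ i, lam i * g i s a) V s a / τ := by
  set c : S → A → ℝ := fun s a => r s a + ∑ i, lam i * g i s a with hc
  set q := softmaxPol fun s a => softQ γ P c V s a / τ with hq_def
  have hq : InSoftmax q := ⟨_, rfl⟩
  have hlog : ∀ s a, τ * Real.log (q s a) = c s a + γ * ∑ s', P s a s' * V s' - V s :=
    mul_log_softmaxPol_softQ hτ hV
  have hle := hmax q hq
  rw [Lag_eq_sum_occupancy hγ hP hπ.isPolicy hρ, Lag_eq_sum_occupancy hγ hP hq.isPolicy hρ,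
    sum_occupancy_regularized hγ hP hπ.isPolicy hρ hlog,
    sum_occupancy_regularized hγ hP hq.isPolicy hρ hlog] at hle
  simp only [sub_self, mul_zero, Finset.sum_const_zero, sub_zero] at hle
  have hν : ∀ s, 0 < ∑ a, occupancy γ P π ρ s a := fun s => by
    have h := hvisit s
    rw [visit_eq_sum_occupancy hγ hP hπ.isPolicy hρ] at h
    exact pos_of_mul_pos_right h (by linarith [hγ.2])
  have hsum : ∀ s, ∑ a, π s a = ∑ a, q s a := fun s => by
    rw [hπ.sum_eq_one, hq.sum_eq_one]
  have hterm : ∀ s ∈ Finset.univ, 0 ≤ (∑ a, occupancy γ P π ρ s a) *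
      ∑ a, π s a * (Real.log (π s a) - Real.log (q s a)) := fun s _ =>
    mul_nonneg (hν s).le (sum_mul_log_sub_log_nonneg (hπ.pos s) (hq.pos s) (hsum s))
  have htot : ∑ s, (∑ a, occupancy γ P π ρ s a) *
      ∑ a, π s a * (Real.log (π s a) - Real.log (q s a)) ≤ 0 := by
    by_contra! h
    linarith [mul_pos hτ h]
  funext s
  refine eq_of_sum_mul_log_sub_log_nonpos (hπ.pos s) (hq.pos s) (hsum s) ?_
  have := (Finset.single_le_sum hterm (Finset.mem_univ s)).trans htot
  exact nonpos_of_mul_nonpos_right this (hν s)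

/-- Sup-norm perturbation bound for the soft optimal policies of two rewards. -/
lemma sum_sq_softmaxPol_softQ_sub_le [Nonempty A] (hγ : γ ∈ Set.Ico (0 : ℝ) 1) (hτ : 0 < τ)
    (hP : IsKernel P) {c₁ c₂ : S → A → ℝ} {ε : ℝ} (hε : 0 ≤ ε)
    (hc : ∀ s a, |c₁ s a - c₂ s a| ≤ ε) {V₁ V₂ : S → ℝ}
    (hV₁ : softBellman γ τ P c₁ V₁ = V₁) (hV₂ : softBellman γ τ P c₂ V₂ = V₂) (s : S) :
    ∑ a, (softmaxPol (fun s a => softQ γ P c₁ V₁ s a / τ) s a -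
      softmaxPol (fun s a => softQ γ P c₂ V₂ s a / τ) s a) ^ 2 ≤
      Fintype.card A * (ε / (τ * (1 - γ))) ^ 2 := by
  have h1γ : 0 < 1 - γ := by linarith [hγ.2]
  have hdist : dist V₁ V₂ ≤ ε + γ * dist V₁ V₂ := by
    simpa only [hV₁, hV₂] using dist_softBellman_le hγ.1 hτ hP hε hc V₁ V₂
  have hQ : ∀ a, |softQ γ P c₁ V₁ s a - softQ γ P c₂ V₂ s a| ≤ ε / (1 - γ) := fun a => by
    refine (abs_softQ_sub_le hγ.1 hP hc s a).trans ?_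
    rw [le_div_iff₀ h1γ]
    nlinarith [hγ.1]
  have h₁ : InSoftmax (softmaxPol fun s a => softQ γ P c₁ V₁ s a / τ) := ⟨_, rfl⟩
  have h₂ : InSoftmax (softmaxPol fun s a => softQ γ P c₂ V₂ s a / τ) := ⟨_, rfl⟩
  refine sum_sq_sub_le_of_log_sub_log (k := (V₂ s - V₁ s) / τ) (h₁.pos s) (h₂.pos s)
    (h₁.sum_eq_one s) (h₂.sum_eq_one s) fun a => ?_
  have e₁ := mul_log_softmaxPol_softQ hτ hV₁ s a
  have e₂ := mul_log_softmaxPol_softQ hτ hV₂ s a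
  rw [mul_comm, ← eq_div_iff hτ.ne'] at e₁ e₂
  rw [e₁, e₂, mul_comm τ, ← div_div, le_div_iff₀ hτ]
  calc _ = |softQ γ P c₁ V₁ s a - softQ γ P c₂ V₂ s a| := by
        rw [← abs_of_pos hτ, ← abs_mul, abs_of_pos hτ]
        congr 1
        field_simp
        ring
    _ ≤ _ := hQ a

end SoftBellman

lemma sum_abs_le_sqrt_mul_vecNorm2 {n : ℕ} (x : Fin n → ℝ) :
    ∑ i, |x i| ≤ Real.sqrt n * vecNorm2 x := by
  rw [vecNorm2, ← Real.sqrt_mul (Nat.cast_nonneg n)]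
  refine Real.le_sqrt_of_sq_le ?_
  simpa [sq_abs] using sq_sum_le_card_mul_sum_sq (s := Finset.univ) (f := fun i => |x i|)

/-- under the Slater, strong duality and exploration assumptions, the
Lagrangian-maximizer map `λ ↦ π_λ` is `ℓ_Λ`-Lipschitz on `Λ`, with
`ℓ_Λ = (√(n|A|)/(1−γ)² + 1)·2·(1−γ)·ln2/(τ·d)`. -/
theorem maximizer_lipschitz_in_multiplier
    {S A : Type} [Fintype S] [Fintype A]
    (P : S → A → S → ℝ) (r : S → A → ℝ) (γ τ : ℝ) (ρ : S → ℝ) {n : ℕ}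
    (g : Fin n → S → A → ℝ) (b : Fin n → ℝ)
    (hP : IsKernel P) (hr : ∀ s a, r s a ∈ Set.Icc (0 : ℝ) 1)
    (hγ : γ ∈ Set.Ico (0 : ℝ) 1) (hρ : IsDist ρ) (hτ : 0 < τ)
    (hg : ∀ i s a, g i s a ∈ Set.Icc (0 : ℝ) 1)
    (hb : ∀ i, b i ∈ Set.Icc (0 : ℝ) (1 / (1 - γ)))
    -- Slater condition
    (πbar : S → A → ℝ) (hbar : InSoftmax πbar) (ξ : Fin n → ℝ) (hξ : ∀ i, 0 < ξ i)
    (hslater : ∀ i, Vval γ P πbar ρ (g i) - b i ≥ ξ i)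
    -- `π_τ*` is an optimal policy of the entropy-regularized CMDP with value `V_τ*`
    (πstar : S → A → ℝ) (hstarIn : InSoftmax πstar)
    (hstarfeas : ∀ i, Vval γ P πstar ρ (g i) ≥ b i)
    (hstaropt : ∀ π : S → A → ℝ, InSoftmax π → (∀ i, Vval γ P π ρ (g i) ≥ b i) →
      Vtau γ τ P π ρ r ≤ Vtau γ τ P πstar ρ r)
    -- strong duality
    (lamstar : Fin n → ℝ) (hlamstar : ∀ i, 0 ≤ lamstar i)
    (hlamstaropt : ∀ μ : Fin n → ℝ, (∀ i, 0 ≤ μ i) →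
      Dual γ τ P ρ r g b lamstar ≤ Dual γ τ P ρ r g b μ)
    (hsd : Vtau γ τ P πstar ρ r = Dual γ τ P ρ r g b lamstar ∧
      Dual γ τ P ρ r g b lamstar = Lag γ τ P ρ r g b πstar lamstar)
    -- exploration assumption
    (d : ℝ) (hd : 0 < d)
    (hexp : ∀ π : S → A → ℝ, InSoftmax π → ∀ s, d ≤ visit γ P π ρ s)
    -- `πsel λ` is a maximizer of `L(·,λ)` over `Π` for each `λ` in `Λ`
    (πsel : (Fin n → ℝ) → S → A → ℝ)
    (hsel : ∀ lam : Fin n → ℝ,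
      (∀ i, 0 ≤ lam i ∧ lam i ≤ (Vtau γ τ P πstar ρ r - Vtau γ τ P πbar ρ r) / ξ i) →
      InSoftmax (πsel lam) ∧ ∀ π' : S → A → ℝ, InSoftmax π' →
        Lag γ τ P ρ r g b π' lam ≤ Lag γ τ P ρ r g b (πsel lam) lam) :
    ∀ lam₁ lam₂ : Fin n → ℝ,
      (∀ i, 0 ≤ lam₁ i ∧ lam₁ i ≤ (Vtau γ τ P πstar ρ r - Vtau γ τ P πbar ρ r) / ξ i) →
      (∀ i, 0 ≤ lam₂ i ∧ lam₂ i ≤ (Vtau γ τ P πstar ρ r - Vtau γ τ P πbar ρ r) / ξ i) →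
      polNorm2 (fun s a => πsel lam₁ s a - πsel lam₂ s a) ≤
        ((Real.sqrt (n * Fintype.card A) / (1 - γ) ^ 2 + 1) *
            (2 * (1 - γ) * Real.log 2) / (τ * d)) *
          vecNorm2 (fun i => lam₁ i - lam₂ i) := by
  intro lam₁ lam₂ h₁ h₂
  have h1γ : 0 < 1 - γ := by linarith [hγ.2]
  have hN : 0 ≤ vecNorm2 (fun i => lam₁ i - lam₂ i) := Real.sqrt_nonneg _
  have hlog2 : 1 ≤ 2 * Real.log 2 := by linarith [Real.log_two_gt_d9]
  rcases isEmpty_or_nonempty A with hA | hA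
  · have : polNorm2 (fun s a => πsel lam₁ s a - πsel lam₂ s a) = 0 := by simp [polNorm2]
    rw [this]
    positivity
  have hcard : (Fintype.card S : ℝ) * d ≤ 1 := by
    rw [← sum_visit hγ hP hbar.isPolicy hρ, ← nsmul_eq_mul, ← Finset.card_univ,
      ← Finset.sum_const]
    exact Finset.sum_le_sum fun s _ => hexp πbar hbar s
  have hsqrtS : Real.sqrt (Fintype.card S) ≤ 1 / d := by
    refine le_trans ?_ ((le_div_iff₀ hd).2 hcard)
    rw [Real.sqrt_le_left (Nat.cast_nonneg _)]
    exact_mod_cast Nat.le_self_pow two_ne_zero _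
  obtain ⟨V₁, hV₁⟩ := exists_softBellman_fixedPoint hγ hτ hP
    fun s a => r s a + ∑ i, lam₁ i * g i s a
  obtain ⟨V₂, hV₂⟩ := exists_softBellman_fixedPoint hγ hτ hP
    fun s a => r s a + ∑ i, lam₂ i * g i s a
  obtain ⟨hs₁, hm₁⟩ := hsel lam₁ h₁
  obtain ⟨hs₂, hm₂⟩ := hsel lam₂ h₂
  have e₁ := eq_softmaxPol_of_forall_Lag_le hγ hτ hP hρ hs₁
    (fun s => hd.trans_le (hexp _ hs₁ s)) hm₁ hV₁
  have e₂ := eq_softmaxPol_of_forall_Lag_le hγ hτ hP hρ hs₂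
    (fun s => hd.trans_le (hexp _ hs₂ s)) hm₂ hV₂
  set N := vecNorm2 (fun i => lam₁ i - lam₂ i)
  have hc : ∀ s a, |(r s a + ∑ i, lam₁ i * g i s a) - (r s a + ∑ i, lam₂ i * g i s a)| ≤
      Real.sqrt n * N := fun s a => by
    rw [add_sub_add_left_eq_sub, ← Finset.sum_sub_distrib]
    refine (Finset.abs_sum_le_sum_abs _ _).trans (le_trans ?_
      (sum_abs_le_sqrt_mul_vecNorm2 fun i => lam₁ i - lam₂ i))
    refine Finset.sum_le_sum fun i _ => ?_
    rw [← sub_mul, abs_mul, abs_of_nonneg (hg i s a).1]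
    exact mul_le_of_le_one_right (abs_nonneg _) (hg i s a).2
  have hε : 0 ≤ Real.sqrt n * N := by positivity
  have hsq : ∑ s, ∑ a, (πsel lam₁ s a - πsel lam₂ s a) ^ 2 ≤
      Fintype.card S * (Fintype.card A * (Real.sqrt n * N / (τ * (1 - γ))) ^ 2) := by
    rw [← nsmul_eq_mul, ← Finset.card_univ, ← Finset.sum_const, e₁, e₂]
    exact Finset.sum_le_sum fun s _ =>
      sum_sq_softmaxPol_softQ_sub_le hγ hτ hP hε hc hV₁ hV₂ s
  calc polNorm2 (fun s a => πsel lam₁ s a - πsel lam₂ s a)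
      ≤ Real.sqrt (Fintype.card S * (Fintype.card A * (Real.sqrt n * N / (τ * (1 - γ))) ^ 2)) :=
        Real.sqrt_le_sqrt hsq
    _ = Real.sqrt (Fintype.card S) *
          (Real.sqrt (Fintype.card A) * (Real.sqrt n * N / (τ * (1 - γ)))) := by
        rw [Real.sqrt_mul (Nat.cast_nonneg _), Real.sqrt_mul (Nat.cast_nonneg _),
          Real.sqrt_sq (by positivity)]
    _ ≤ 1 / d * (Real.sqrt (Fintype.card A) * (Real.sqrt n * N / (τ * (1 - γ)))) :=
        mul_le_mul_of_nonneg_right hsqrtS (by positivity)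
    _ = Real.sqrt (n * Fintype.card A) / (1 - γ) ^ 2 * ((1 - γ) * 1) / (τ * d) * N := by
        rw [Real.sqrt_mul (Nat.cast_nonneg _)]
        field_simp
    _ ≤ _ := by
        rw [show 2 * (1 - γ) * Real.log 2 = (1 - γ) * (2 * Real.log 2) by ring]
        gcongr
        linarith
end
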